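/- arXiv:1210.4081 — 3 statements merged into one kernel-verified Lean document; each statement's English description precedes it below -/
import Mathlib

section
/- Let f : X × Y → ℝ be convex and Lipschitz-continuous w.r.t. y with constant L_Y(f), and let f* be the minimum of f on D, attained at some point of D. Let (x,y) ∈ X × Y with x feasible w.r.t. D, i.e. x ∈ D_X (so that the Euclidean projection of x onto D_X is x itself), write z = (x,y), let z^p = (x^p, y^p) be a Euclidean projection of z onto D, and let y′ minimize f(x,·) over {ỹ ∈ Y : (x,ỹ) ∈ D}. Assume in addition that (x, y^p) ∈ D. Then the tighter inequality |f(x,y′) − f*| ≤ |f(x,y) − f*| + L_Y(f)·‖z − z^p‖ holds. (Paper's Theorem 1, inequality (13).) -/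
open scoped RealInnerProductSpace

/-- Paper's Theorem 1, inequality (13): when `x` is feasible w.r.t. `D`
(i.e. `x ∈ D_X`), the tighter bound
`|f(x,y') − f*| ≤ |f(x,y) − f*| + L_Y(f)·‖z − z^p‖` holds. -/
theorem optimizing_projection_bound_feasible_x {n m : ℕ}
    (X : Set (EuclideanSpace ℝ (Fin n))) (Y : Set (EuclideanSpace ℝ (Fin m)))
    (D : Set (EuclideanSpace ℝ (Fin n) × EuclideanSpace ℝ (Fin m)))
    (hDsub : D ⊆ X ×ˢ Y) (hDne : D.Nonempty) (hDclosed : IsClosed D)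
    (hDconv : Convex ℝ D)
    (f : EuclideanSpace ℝ (Fin n) × EuclideanSpace ℝ (Fin m) → ℝ)
    (hconv : ConvexOn ℝ (X ×ˢ Y) f)
    (LY : ℝ)
    (hLY : ∀ x₁ ∈ X, ∀ y₁ ∈ Y, ∀ y₂ ∈ Y, |f (x₁, y₁) - f (x₁, y₂)| ≤ LY * ‖y₁ - y₂‖)
    (fstar : ℝ) (hattained : ∃ z ∈ D, f z = fstar)
    (hmin : ∀ z ∈ D, fstar ≤ f z)
    (x : EuclideanSpace ℝ (Fin n)) (y : EuclideanSpace ℝ (Fin m))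
    (hx : x ∈ X) (hy : y ∈ Y)
    -- x is feasible w.r.t. D, i.e. x ∈ D_X
    (hxfeas : x ∈ {u ∈ X | ∃ w ∈ Y, (u, w) ∈ D})
    -- z^p = (x^p, y^p) is a Euclidean projection of z = (x,y) onto D
    (xp : EuclideanSpace ℝ (Fin n)) (yp : EuclideanSpace ℝ (Fin m))
    (hzpD : (xp, yp) ∈ D)
    (hzpProj : ∀ w ∈ D,
      Real.sqrt (‖x - xp‖ ^ 2 + ‖y - yp‖ ^ 2) ≤
        Real.sqrt (‖x - w.1‖ ^ 2 + ‖y - w.2‖ ^ 2))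
    -- y' minimizes f(x,·) over {w ∈ Y : (x,w) ∈ D}
    (y' : EuclideanSpace ℝ (Fin m))
    (hy'Y : y' ∈ Y) (hy'D : (x, y') ∈ D)
    (hy'min : ∀ w ∈ Y, (x, w) ∈ D → f (x, y') ≤ f (x, w))
    -- additional assumption: the slice point (x, y^p) is in D
    (hslice : (x, yp) ∈ D) :
    |f (x, y') - fstar| ≤
      |f (x, y) - fstar| + LY * Real.sqrt (‖x - xp‖ ^ 2 + ‖y - yp‖ ^ 2) := by
  have hyp : yp ∈ Y := (hDsub hslice).2
  have hproj := hzpProj (x, yp) hslice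
  have hdist : Real.sqrt (‖x - xp‖ ^ 2 + ‖y - yp‖ ^ 2) = ‖y - yp‖ := by
    apply le_antisymm
    · simpa using hproj
    · exact Real.le_sqrt_of_sq_le (by nlinarith [sq_nonneg ‖x - xp‖])
  have hlip := (abs_le.mp (hLY x hx y hy yp hyp)).1
  have hopt := hy'min yp hyp hslice
  rw [hdist, abs_of_nonneg (sub_nonneg.mpr (hmin _ hy'D))]
  linarith [le_abs_self (f (x, y) - fstar)]
end

section
/- Let f : X × Y → ℝ be convex and Lipschitz-continuous w.r.t. x with constant L_X(f) and w.r.t. y with constant L_Y(f), and let f* be the minimum of f on D, attained at some point of D. Let z^t = (x^t, y^t) ∈ X × Y, t = 1, 2, …, be a sequence such that |f(z^t) − f*| → 0 and ‖z^t − Π_D(z^t)‖ → 0 as t → ∞, where Π_D(z^t) = (x^{p,t}, y^{p,t}) is a Euclidean projection of z^t onto D. For each t let x′^t be a Euclidean projection of x^t onto D_X and let y′^t minimize f(x′^t,·) over {y ∈ Y : (x′^t, y) ∈ D}, and assume (x′^t, y^{p,t}) ∈ D. Then (x′^t, y′^t) ∈ D for all t, and f(x′^t, y′^t) → f* as t →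 ∞; i.e., the optimizing projections form a feasible sequence whose objective values converge to the optimal value. -/
open scoped RealInnerProductSpace

/-- Convergence of the optimizing projections: if the (in general infeasible)
sequence `z^t = (x^t, y^t)` satisfies `|f(z^t) − f*| → 0` and
`‖z^t − Π_D(z^t)‖ → 0`, then the optimizing projections `(x'^t, y'^t)` are
feasible and `f(x'^t, y'^t) → f*`. -/
theorem optimizing_projection_convergence {n m : ℕ}
    (X : Set (EuclideanSpace ℝ (Fin n))) (Y : Set (EuclideanSpace ℝ (Fin m)))
    (D : Set (EuclideanSpace ℝ (Fin n) × EuclideanSpace ℝ (Fin m)))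
    (hDsub : D ⊆ X ×ˢ Y) (hDne : D.Nonempty) (hDclosed : IsClosed D)
    (hDconv : Convex ℝ D)
    (f : EuclideanSpace ℝ (Fin n) × EuclideanSpace ℝ (Fin m) → ℝ)
    (hconv : ConvexOn ℝ (X ×ˢ Y) f)
    (LX LY : ℝ)
    (hLX : ∀ y ∈ Y, ∀ x₁ ∈ X, ∀ x₂ ∈ X, |f (x₁, y) - f (x₂, y)| ≤ LX * ‖x₁ - x₂‖)
    (hLY : ∀ x₁ ∈ X, ∀ y₁ ∈ Y, ∀ y₂ ∈ Y, |f (x₁, y₁) - f (x₁, y₂)| ≤ LY * ‖y₁ - y₂‖)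
    (fstar : ℝ) (hattained : ∃ z ∈ D, f z = fstar)
    (hmin : ∀ z ∈ D, fstar ≤ f z)
    -- the sequence z^t = (x^t, y^t) ∈ X × Y
    (x : ℕ → EuclideanSpace ℝ (Fin n)) (y : ℕ → EuclideanSpace ℝ (Fin m))
    (hx : ∀ t, x t ∈ X) (hy : ∀ t, y t ∈ Y)
    -- Π_D(z^t) = (x^{p,t}, y^{p,t}) is a Euclidean projection of z^t onto D
    (xp : ℕ → EuclideanSpace ℝ (Fin n)) (yp : ℕ → EuclideanSpace ℝ (Fin m))
    (hzpD : ∀ t, (xp t, yp t) ∈ D)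
    (hzpProj : ∀ t, ∀ w ∈ D,
      Real.sqrt (‖x t - xp t‖ ^ 2 + ‖y t - yp t‖ ^ 2) ≤
        Real.sqrt (‖x t - w.1‖ ^ 2 + ‖y t - w.2‖ ^ 2))
    -- convergence assumptions on the infeasible sequence
    (hfconv : Filter.Tendsto (fun t => |f (x t, y t) - fstar|) Filter.atTop (nhds 0))
    (hdistconv : Filter.Tendsto
      (fun t => Real.sqrt (‖x t - xp t‖ ^ 2 + ‖y t - yp t‖ ^ 2)) Filter.atTop (nhds 0))
    -- x'^t is a Euclidean projection of x^t onto D_X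
    (x' : ℕ → EuclideanSpace ℝ (Fin n))
    (hx'mem : ∀ t, x' t ∈ {u ∈ X | ∃ w ∈ Y, (u, w) ∈ D})
    (hx'proj : ∀ t, ∀ u ∈ {u ∈ X | ∃ w ∈ Y, (u, w) ∈ D}, ‖x t - x' t‖ ≤ ‖x t - u‖)
    -- y'^t minimizes f(x'^t,·) over {w ∈ Y : (x'^t,w) ∈ D}
    (y' : ℕ → EuclideanSpace ℝ (Fin m))
    (hy'Y : ∀ t, y' t ∈ Y) (hy'D : ∀ t, (x' t, y' t) ∈ D)
    (hy'min : ∀ t, ∀ w ∈ Y, (x' t, w) ∈ D → f (x' t, y' t) ≤ f (x' t, w))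
    -- additional assumption: the slice points (x'^t, y^{p,t}) are in D
    (hslice : ∀ t, (x' t, yp t) ∈ D) :
    (∀ t, (x' t, y' t) ∈ D) ∧
      Filter.Tendsto (fun t => f (x' t, y' t)) Filter.atTop (nhds fstar) := by
  refine ⟨hy'D, ?_⟩
  set d : ℕ → ℝ := fun t => Real.sqrt (‖x t - xp t‖ ^ 2 + ‖y t - yp t‖ ^ 2)
  have hupper : ∀ t, f (x' t, y' t) ≤
      fstar + (|f (x t, y t) - fstar| + (|LX| * d t + |LY| * d t)) := by
    intro t
    have hypY : yp t ∈ Y := (hDsub (hzpD t)).2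
    have hxd : ‖x' t - x t‖ ≤ d t :=
      calc ‖x' t - x t‖ = ‖x t - x' t‖ := norm_sub_rev _ _
        _ ≤ ‖x t - xp t‖ := hx'proj t _ ⟨(hDsub (hzpD t)).1, yp t, hypY, hzpD t⟩
        _ ≤ d t := Real.le_sqrt_of_sq_le (by linarith [sq_nonneg ‖y t - yp t‖])
    have hyd : ‖yp t - y t‖ ≤ d t :=
      calc ‖yp t - y t‖ = ‖y t - yp t‖ := norm_sub_rev _ _
        _ ≤ d t := Real.le_sqrt_of_sq_le (by linarith [sq_nonneg ‖x t - xp t‖])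
    have hfx : f (x' t, yp t) - f (x t, yp t) ≤ |LX| * d t :=
      calc f (x' t, yp t) - f (x t, yp t) ≤ LX * ‖x' t - x t‖ :=
            (le_abs_self _).trans (hLX _ hypY _ (hx'mem t).1 _ (hx t))
        _ ≤ |LX| * d t := by gcongr; exact le_abs_self _
    have hfy : f (x t, yp t) - f (x t, y t) ≤ |LY| * d t :=
      calc f (x t, yp t) - f (x t, y t) ≤ LY * ‖yp t - y t‖ :=
            (le_abs_self _).trans (hLY _ (hx t) _ hypY _ (hy t))
        _ ≤ |LY| * d t := by gcongr; exact le_abs_self _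
    linarith [hy'min t _ hypY (hslice t), le_abs_self (f (x t, y t) - fstar)]
  refine tendsto_of_tendsto_of_tendsto_of_le_of_le tendsto_const_nhds ?_
    (fun t => hmin _ (hy'D t)) hupper
  simpa using (hfconv.add ((hdistconv.const_mul |LX|).add
    (hdistconv.const_mul |LY|))).const_add fstar
end

section
/- Consider the separable linear program with objective f(x,y) = Σ_{i∈I} ⟨a_i, x_i⟩ + Σ_{j∈J} ⟨b_j, y_j⟩ and feasible set D = {(x,y) : x_i ∈ ℝⁿ₊, y_j ∈ ℝᵐ₊, A_{ij} y_j = x_i for all i ∈ N(j), j ∈ J, and B_i x_i = c_i for all i ∈ I}, assumed nonempty, with optimal value f* attained. Let (x^t, y^t), t = 1, 2, …, be a sequence of (in general infeasible) points with f(x^t, y^t) → f* and ‖(x^t,y^t) − Π_D(x^t,y^t)‖ → 0, where Π_D(x^t,y^t) = (x^{p,t}, y^{p,t}) is a Euclidean projection onto D. For each t define P(x^t, y^t) = (x′^t, y′^t) by: x′^t_i is the Euclidean projection of x^t_i onto the nonempty set {x̃ ∈ ℝⁿ₊ : B_i x̃ = c_i}, and y′^t_j minimizes ⟨b_j, y_j⟩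 over the nonempty set {y_j ∈ ℝᵐ₊ : A_{ij} y_j = x′^t_i for all i ∈ N(j)}. Assume additionally that (x′^t, y^{p,t}) ∈ D for all t. Then P(x^t, y^t) ∈ D for every t, and f(P(x^t, y^t)) → f* as t → ∞. -/
open scoped RealInnerProductSpace

/-- The feasible set of the separable linear program (1):
`A_{ij} y_j = x_i` for `i ∈ N(j)`, `B_i x_i = c_i`, `x ≥ 0`, `y ≥ 0`. -/
def sepLPFeasible {n m k N M : ℕ}
    (A : Fin N → Fin M → Matrix (Fin n) (Fin m) ℝ)
    (B : Fin N → Matrix (Fin k) (Fin n) ℝ)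
    (c : Fin N → Fin k → ℝ)
    (Nbr : Fin M → Finset (Fin N)) :
    Set ((Fin N → EuclideanSpace ℝ (Fin n)) × (Fin M → EuclideanSpace ℝ (Fin m))) :=
  {p | (∀ i l, 0 ≤ p.1 i l) ∧ (∀ j l, 0 ≤ p.2 j l) ∧
    (∀ j, ∀ i ∈ Nbr j, (A i j).mulVec (p.2 j) = p.1 i) ∧
    (∀ i, (B i).mulVec (p.1 i) = c i)}

/-- The separable linear objective of problem (1). -/
noncomputable def sepLPObj {n m : ℕ} {N M : ℕ}
    (a : Fin N → EuclideanSpace ℝ (Fin n)) (b : Fin M → EuclideanSpace ℝ (Fin m))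
    (x : Fin N → EuclideanSpace ℝ (Fin n)) (y : Fin M → EuclideanSpace ℝ (Fin m)) : ℝ :=
  ∑ i, ⟪a i, x i⟫ + ∑ j, ⟪b j, y j⟫

theorem tendsto_sepLPObj_of_tendsto_sub {n m N M : ℕ}
    (a : Fin N → EuclideanSpace ℝ (Fin n)) (b : Fin M → EuclideanSpace ℝ (Fin m))
    {x u : ℕ → Fin N → EuclideanSpace ℝ (Fin n)} {y v : ℕ → Fin M → EuclideanSpace ℝ (Fin m)}
    {r : ℝ}
    (hf : Filter.Tendsto (fun t => sepLPObj a b (x t) (y t)) Filter.atTop (nhds r))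
    (hx : ∀ i, Filter.Tendsto (fun t => x t i - u t i) Filter.atTop (nhds 0))
    (hy : ∀ j, Filter.Tendsto (fun t => y t j - v t j) Filter.atTop (nhds 0)) :
    Filter.Tendsto (fun t => sepLPObj a b (u t) (v t)) Filter.atTop (nhds r) := by
  have hdiff : Filter.Tendsto (fun t => sepLPObj a b (x t - u t) (y t - v t))
      Filter.atTop (nhds 0) := by
    have h := (tendsto_finsetSum Finset.univ fun i _ =>
      (tendsto_const_nhds (x := a i)).inner (𝕜 := ℝ) (hx i)).add
      (tendsto_finsetSum Finset.univ fun j _ =>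
        (tendsto_const_nhds (x := b j)).inner (𝕜 := ℝ) (hy j))
    simpa [sepLPObj] using h
  refine (sub_zero r ▸ hf.sub hdiff).congr fun t => ?_
  simp only [sepLPObj, Pi.sub_apply, inner_sub_right, Finset.sum_sub_distrib]
  ring

/-- Main result of the paper for the separable LP (1): if the (in general
infeasible) iterates `(x^t, y^t)` converge to the set of optimal solutions,
then the cheaply computed feasible points `P(x^t, y^t) = (x'^t, y'^t)` are
feasible and their objective values converge to the optimal value. -/
theorem sepLP_optimizing_projection_convergence {n m k N M : ℕ}
    (A : Fin N → Fin M → Matrix (Fin n) (Fin m) ℝ)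
    (B : Fin N → Matrix (Fin k) (Fin n) ℝ)
    (a : Fin N → EuclideanSpace ℝ (Fin n))
    (b : Fin M → EuclideanSpace ℝ (Fin m))
    (c : Fin N → Fin k → ℝ)
    (Nbr : Fin M → Finset (Fin N))
    (hne : (sepLPFeasible A B c Nbr).Nonempty)
    (fstar : ℝ)
    (hattained : ∃ p ∈ sepLPFeasible A B c Nbr, sepLPObj a b p.1 p.2 = fstar)
    (hmin : ∀ p ∈ sepLPFeasible A B c Nbr, fstar ≤ sepLPObj a b p.1 p.2)
    -- the (in general infeasible) sequence (x^t, y^t)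
    (x : ℕ → Fin N → EuclideanSpace ℝ (Fin n))
    (y : ℕ → Fin M → EuclideanSpace ℝ (Fin m))
    -- (x^{p,t}, y^{p,t}) is a Euclidean projection of (x^t, y^t) onto D
    (xp : ℕ → Fin N → EuclideanSpace ℝ (Fin n))
    (yp : ℕ → Fin M → EuclideanSpace ℝ (Fin m))
    (hzpD : ∀ t, (xp t, yp t) ∈ sepLPFeasible A B c Nbr)
    (hzpProj : ∀ t, ∀ w ∈ sepLPFeasible A B c Nbr,
      Real.sqrt (∑ i, ‖x t i - xp t i‖ ^ 2 + ∑ j, ‖y t j - yp t j‖ ^ 2) ≤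
        Real.sqrt (∑ i, ‖x t i - w.1 i‖ ^ 2 + ∑ j, ‖y t j - w.2 j‖ ^ 2))
    -- convergence of the infeasible sequence to the optimum
    (hfconv : Filter.Tendsto (fun t => sepLPObj a b (x t) (y t)) Filter.atTop (nhds fstar))
    (hdistconv : Filter.Tendsto
      (fun t => Real.sqrt (∑ i, ‖x t i - xp t i‖ ^ 2 + ∑ j, ‖y t j - yp t j‖ ^ 2))
      Filter.atTop (nhds 0))
    -- x'^t_i is the Euclidean projection of x^t_i onto {x̃ ≥ 0 : B_i x̃ = c_i}
    (x' : ℕ → Fin N → EuclideanSpace ℝ (Fin n))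
    (hx'mem : ∀ t i, (∀ l, 0 ≤ x' t i l) ∧ (B i).mulVec (x' t i) = c i)
    (hx'proj : ∀ t i, ∀ u : EuclideanSpace ℝ (Fin n),
      (∀ l, 0 ≤ u l) → (B i).mulVec u = c i → ‖x t i - x' t i‖ ≤ ‖x t i - u‖)
    -- y'^t_j minimizes ⟨b_j,·⟩ over {y_j ≥ 0 : A_{ij} y_j = x'^t_i, i ∈ N(j)}
    (y' : ℕ → Fin M → EuclideanSpace ℝ (Fin m))
    (hy'mem : ∀ t j, (∀ l, 0 ≤ y' t j l) ∧
      ∀ i ∈ Nbr j, (A i j).mulVec (y' t j) = x' t i)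
    (hy'min : ∀ t j, ∀ w : EuclideanSpace ℝ (Fin m), (∀ l, 0 ≤ w l) →
      (∀ i ∈ Nbr j, (A i j).mulVec w = x' t i) → ⟪b j, y' t j⟫ ≤ ⟪b j, w⟫)
    -- additional assumption: (x'^t, y^{p,t}) ∈ D
    (hslice : ∀ t, (x' t, yp t) ∈ sepLPFeasible A B c Nbr) :
    (∀ t, (x' t, y' t) ∈ sepLPFeasible A B c Nbr) ∧
      Filter.Tendsto (fun t => sepLPObj a b (x' t) (y' t)) Filter.atTop (nhds fstar) := by
  have hfeas : ∀ t, (x' t, y' t) ∈ sepLPFeasible A B c Nbr := fun t =>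
    ⟨fun i => (hx'mem t i).1, fun j => (hy'mem t j).1, fun j => (hy'mem t j).2,
      fun i => (hx'mem t i).2⟩
  refine ⟨hfeas, ?_⟩
  have hx : ∀ i, Filter.Tendsto (fun t => x t i - x' t i) Filter.atTop (nhds 0) := by
    refine fun i => squeeze_zero_norm (fun t => ?_) hdistconv
    refine (hx'proj t i (xp t i) ((hzpD t).1 i) ((hzpD t).2.2.2 i)).trans (Real.le_sqrt_of_sq_le ?_)
    exact (Finset.single_le_sum (f := fun i => ‖x t i - xp t i‖ ^ 2)
      (fun _ _ => by positivity) (Finset.mem_univ i)).trans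
      (le_add_of_nonneg_right (by positivity))
  have hy : ∀ j, Filter.Tendsto (fun t => y t j - yp t j) Filter.atTop (nhds 0) := by
    refine fun j => squeeze_zero_norm (fun t => Real.le_sqrt_of_sq_le ?_) hdistconv
    exact (Finset.single_le_sum (f := fun j => ‖y t j - yp t j‖ ^ 2)
      (fun _ _ => by positivity) (Finset.mem_univ j)).trans
      (le_add_of_nonneg_left (by positivity))
  have hlim : Filter.Tendsto (fun t => sepLPObj a b (x' t) (yp t)) Filter.atTop (nhds fstar) :=
    tendsto_sepLPObj_of_tendsto_sub a b hfconv hx hy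
  have hle : ∀ t, sepLPObj a b (x' t) (y' t) ≤ sepLPObj a b (x' t) (yp t) := fun t =>
    add_le_add le_rfl (Finset.sum_le_sum fun j _ =>
      hy'min t j (yp t j) ((hslice t).2.1 j) ((hslice t).2.2.1 j))
  have hge : ∀ t, fstar ≤ sepLPObj a b (x' t) (y' t) := fun t => hmin _ (hfeas t)
  exact tendsto_of_tendsto_of_tendsto_of_le_of_le tendsto_const_nhds hlim hge hle
end
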